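/- Let α, D, λ > 0, k > 3/2 and 0 < η < 2/3, and let D₂ > max{ (3D/(2 − 2√(3η/2)))·max{1, λ}², 6D/(1 − √(3η/2)) }. There exists a constant C > 0 such that for all t ≥ 0 and x ∈ ℝ³, ∫₀^t ∫_{{|y| ≤ λs}} e^{−(|x−y|+(t−s))/D} (1+s)^{−α} B_k(s, |y|) dy ds ≤ C (1+t)^{−α} e^{−3(|x|−λt)²/(2D₂(1+t))} + C (1+t)^{−α} B_k(t, |x|) 1_{{|x| ≤ λt}} + C e^{−3(|x|+t)/(2D₂)}. -/

import Mathlib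

open MeasureTheory Real
open scoped ENNReal

noncomputable section

abbrev E3 : Type := EuclideanSpace ℝ (Fin 3)

/-- The space–time diffusive profile `B_k(t,z) = (1 + z²/(1+t))^{-k}`. -/
def Bprof (k t z : ℝ) : ℝ := (1 + z ^ 2 / (1 + t)) ^ (-k)

/-- Powers of `1 + u` are dominated by any growing exponential on the half line. -/
lemma exists_one_add_rpow_le_mul_exp {p a : ℝ} (hp : 0 < p) (ha : 0 < a) :
    ∃ C > (0 : ℝ), ∀ u : ℝ, 0 ≤ u → (1 + u) ^ p ≤ C * exp (a * u) := by
  refine ⟨exp (a - p - p * log (a / p)), exp_pos _, fun u hu => ?_⟩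
  have hu1 : 0 < 1 + u := by linarith
  have hap : 0 < a / p := div_pos ha hp
  have hlog : log (1 + u) ≤ a / p * (1 + u) - 1 - log (a / p) := by
    have h := log_le_sub_one_of_pos (mul_pos hap hu1)
    rw [log_mul hap.ne' hu1.ne'] at h
    linarith
  have hmul := mul_le_mul_of_nonneg_right hlog hp.le
  rw [rpow_def_of_pos hu1, ← exp_add, exp_le_exp]
  calc log (1 + u) * p ≤ (a / p * (1 + u) - 1 - log (a / p)) * p := hmul
    _ = a - p - p * log (a / p) + a * u := by field_simp; ring

lemma lintegral_exp_neg_mul_norm_ne_top {E : Type*} [NormedAddCommGroup E] [NormedSpace ℝ E]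
    [FiniteDimensional ℝ E] [MeasurableSpace E] [BorelSpace E] (μ : Measure E)
    [μ.IsAddHaarMeasure] {a : ℝ} (ha : 0 < a) :
    ∫⁻ x : E, ENNReal.ofReal (exp (-a * ‖x‖)) ∂μ ≠ ∞ := by
  set p : ℝ := Module.finrank ℝ E + 1 with hp_def
  have hp : 0 < p := by positivity
  obtain ⟨C, hC, hle⟩ := exists_one_add_rpow_le_mul_exp hp ha
  have hint : Integrable (fun x : E => C * (1 + ‖x‖) ^ (-p)) μ :=
    (integrable_one_add_norm (by rw [hp_def]; linarith)).const_mul C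
  refine ne_top_of_le_ne_top hint.lintegral_lt_top.ne (lintegral_mono fun x => ?_)
  refine ENNReal.ofReal_le_ofReal ?_
  have hx : 0 < 1 + ‖x‖ := by positivity
  have h := hle ‖x‖ (norm_nonneg x)
  rw [rpow_neg hx.le, ← div_eq_mul_inv, le_div_iff₀ (rpow_pos_of_pos hx _), neg_mul, exp_neg,
    inv_mul_le_iff₀ (exp_pos _)]
  linarith

/-- A kernel dominated by a product of exponentials localized around `(t, x)` has space-time
integral controlled uniformly in `(t, x)`. -/
lemma exists_setLIntegral_le_of_le_exp {a : ℝ} (ha : 0 < a) :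
    ∃ K > (0 : ℝ), ∀ (t : ℝ) (x : E3) (M : ℝ) (S : ℝ → Set E3) (f : ℝ → E3 → ℝ), 0 ≤ M →
      (∀ s, MeasurableSet (S s)) →
      (∀ s ∈ Set.Icc 0 t, ∀ y ∈ S s,
        f s y ≤ M * (exp (-a * ‖t - s‖) * exp (-a * ‖x - y‖))) →
      ∫⁻ s in Set.Icc 0 t, ∫⁻ y in S s, ENNReal.ofReal (f s y) ≤ ENNReal.ofReal (M * K) := by
  have h1 := lintegral_exp_neg_mul_norm_ne_top (volume : Measure ℝ) ha
  have h3 := lintegral_exp_neg_mul_norm_ne_top (volume : Measure E3) ha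
  set J₁ := ∫⁻ s : ℝ, ENNReal.ofReal (exp (-a * ‖s‖)) with hJ₁
  set J₃ := ∫⁻ y : E3, ENNReal.ofReal (exp (-a * ‖y‖)) with hJ₃
  refine ⟨(J₁ * J₃).toReal + 1, by positivity, fun t x M S f hM hS hf => ?_⟩
  calc ∫⁻ s in Set.Icc 0 t, ∫⁻ y in S s, ENNReal.ofReal (f s y)
      ≤ ∫⁻ s in Set.Icc 0 t, ∫⁻ y in S s, ENNReal.ofReal M *
          (ENNReal.ofReal (exp (-a * ‖t - s‖)) * ENNReal.ofReal (exp (-a * ‖x - y‖))) := by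
        refine setLIntegral_mono' measurableSet_Icc fun s hs => ?_
        refine setLIntegral_mono' (hS s) fun y hy => ?_
        rw [← ENNReal.ofReal_mul (exp_pos _).le, ← ENNReal.ofReal_mul hM]
        exact ENNReal.ofReal_le_ofReal (hf s hs y hy)
    _ ≤ ∫⁻ s : ℝ, ∫⁻ y : E3, ENNReal.ofReal M *
          (ENNReal.ofReal (exp (-a * ‖t - s‖)) * ENNReal.ofReal (exp (-a * ‖x - y‖))) :=
        (setLIntegral_le_lintegral _ _).trans
          (lintegral_mono fun s => setLIntegral_le_lintegral _ _)
    _ = ENNReal.ofReal M * (J₁ * J₃) := by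
        have hy : ∫⁻ y : E3, ENNReal.ofReal (exp (-a * ‖x - y‖)) = J₃ :=
          lintegral_sub_left_eq_self (fun y : E3 => ENNReal.ofReal (exp (-a * ‖y‖))) x
        have hs : ∫⁻ s : ℝ, ENNReal.ofReal (exp (-a * ‖t - s‖)) = J₁ :=
          lintegral_sub_left_eq_self (fun s : ℝ => ENNReal.ofReal (exp (-a * ‖s‖))) t
        simp_rw [lintegral_const_mul' _ _ ENNReal.ofReal_ne_top, hy]
        rw [lintegral_mul_const' _ _ h3, hs]
    _ ≤ ENNReal.ofReal (M * ((J₁ * J₃).toReal + 1)) := by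
        rw [ENNReal.ofReal_mul hM]
        gcongr
        rw [← ENNReal.ofReal_toReal (ENNReal.mul_ne_top h1 h3)]
        refine ENNReal.ofReal_le_ofReal ?_
        rw [ENNReal.toReal_ofReal ENNReal.toReal_nonneg]
        linarith

lemma one_add_rpow_neg_le {α s t : ℝ} (hα : 0 ≤ α) (hs : 0 ≤ s) (hst : s ≤ t) :
    (1 + s) ^ (-α) ≤ (1 + t) ^ (-α) * (1 + (t - s)) ^ α := by
  have hs' : 0 < 1 + s := by linarith
  have ht' : 0 < 1 + t := by linarith
  have hts : 0 < 1 + (t - s) := by linarith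
  have h : (1 + t) ^ α ≤ (1 + s) ^ α * (1 + (t - s)) ^ α := by
    rw [← mul_rpow hs'.le hts.le]
    refine rpow_le_rpow ht'.le ?_ hα
    nlinarith [mul_nonneg hs (sub_nonneg.2 hst)]
  rw [rpow_neg hs'.le, rpow_neg ht'.le, inv_mul_eq_div, inv_eq_one_div,
    div_le_div_iff₀ (rpow_pos_of_pos hs' _) (rpow_pos_of_pos ht' _)]
  linarith

lemma Bprof_nonneg (k : ℝ) {t : ℝ} (ht : 0 ≤ t) (z : ℝ) : 0 ≤ Bprof k t z := by
  unfold Bprof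
  positivity

lemma Bprof_le_one {k t : ℝ} (hk : 0 ≤ k) (ht : 0 ≤ t) (z : ℝ) : Bprof k t z ≤ 1 := by
  have h : 0 ≤ z ^ 2 / (1 + t) := by positivity
  exact rpow_le_one_of_one_le_of_nonpos (by linarith) (by linarith)

lemma Bprof_le_mul {k s t r w u : ℝ} (hk : 0 ≤ k) (hs : 0 ≤ s) (hst : s ≤ t) (hr : 0 ≤ r)
    (hu : 0 ≤ u) (hrwu : r ≤ w + u) :
    Bprof k s w ≤ 2 ^ k * Bprof k t r * (1 + u) ^ (2 * k) := by
  have hs' : 0 < 1 + s := by linarith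
  have ht' : 0 < 1 + t := by linarith
  have hP : 0 < 1 + w ^ 2 / (1 + s) := by positivity
  have hQ : 0 < 1 + r ^ 2 / (1 + t) := by positivity
  have hle : 1 + r ^ 2 / (1 + t) ≤ 2 * (1 + u) ^ 2 * (1 + w ^ 2 / (1 + s)) := by
    have h1 : r ^ 2 / (1 + t) ≤ 2 * (w ^ 2 / (1 + s)) + 2 * u ^ 2 := by
      calc r ^ 2 / (1 + t) ≤ (2 * w ^ 2 + 2 * u ^ 2) / (1 + t) := by
            gcongr
            nlinarith [sq_nonneg (w - u), mul_self_le_mul_self hr hrwu]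
        _ = 2 * (w ^ 2 / (1 + t)) + 2 * (u ^ 2 / (1 + t)) := by ring
        _ ≤ 2 * (w ^ 2 / (1 + s)) + 2 * u ^ 2 := by
            gcongr
            exact div_le_self (sq_nonneg u) (by linarith)
    have h2 : 0 ≤ w ^ 2 / (1 + s) := by positivity
    nlinarith [mul_nonneg h2 hu, mul_nonneg h2 (sq_nonneg u)]
  have h := rpow_le_rpow hQ.le hle hk
  rw [mul_rpow (by positivity) hP.le, mul_rpow (by norm_num) (by positivity),
    ← rpow_natCast (1 + u), ← rpow_mul (by linarith), Nat.cast_ofNat] at h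
  unfold Bprof
  rw [rpow_neg hP.le, rpow_neg hQ.le, mul_right_comm, ← div_eq_mul_inv, inv_eq_one_div,
    div_le_div_iff₀ (rpow_pos_of_pos hP _) (rpow_pos_of_pos hQ _)]
  linarith

/-- Outside the cone, exponential decay in the distance `r - λt` to the cone is either Gaussian
decay in that distance or exponential decay in `r + t`. -/
lemma rpow_mul_exp_neg_dist_le {α D lam D₂ t r : ℝ} (hα : 0 ≤ α) (hD : 0 < D)
    (h6 : 6 * D ≤ D₂) (hlam : 3 / 2 * D * lam ^ 2 ≤ D₂) (ht : 0 ≤ t) (hr : lam * t ≤ r) :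
    (1 + t) ^ (-α) * exp (-(3 * (r - lam * t) / (4 * D))) ≤
      (1 + t) ^ (-α) * exp (-3 * (r - lam * t) ^ 2 / (2 * D₂ * (1 + t))) +
        exp (-3 * (r + t) / (2 * D₂)) := by
  have hD₂ : 0 < D₂ := by linarith
  have ht' : 0 < 1 + t := by linarith
  have hpow : 0 ≤ (1 + t) ^ (-α) := (rpow_pos_of_pos ht' _).le
  obtain ⟨d, hd⟩ : ∃ d, d = r - lam * t := ⟨_, rfl⟩
  have hd0 : 0 ≤ d := by linarith
  obtain rfl : r = d + lam * t := by linarith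
  rw [← hd]
  rcases le_total (2 * D * d) (D₂ * (1 + t)) with h | h
  · refine le_add_of_le_of_nonneg (mul_le_mul_of_nonneg_left ?_ hpow) (exp_pos _).le
    rw [exp_le_exp, neg_mul, neg_div, neg_le_neg_iff, div_le_div_iff₀ (by positivity)
      (by positivity)]
    nlinarith [mul_le_mul_of_nonneg_left h hd0]
  · refine le_add_of_nonneg_of_le (mul_nonneg hpow (exp_pos _).le) ?_
    refine (mul_le_of_le_one_left (exp_pos _).le
      (rpow_le_one_of_one_le_of_nonpos (by linarith) (by linarith))).trans ?_
    rw [exp_le_exp, neg_mul, neg_div, neg_le_neg_iff, div_le_div_iff₀ (by positivity)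
      (by positivity)]
    have hlin : 2 * D * ((1 + lam) * t) ≤ 2 * D₂ * t := by
      nlinarith [mul_nonneg hD.le ht, mul_nonneg (mul_nonneg hD.le ht) (sq_nonneg (lam - 1)),
        mul_le_mul_of_nonneg_right h6 ht, mul_le_mul_of_nonneg_right hlam ht]
    have hgap : 2 * D₂ * t ≤ (D₂ - 2 * D) * d := by
      have h4 : 4 * D * d ≤ (D₂ - 2 * D) * d := mul_le_mul_of_nonneg_right (by linarith) hd0
      linarith
    nlinarith

/-- Coupling of the exponentially localized wave with an algebraic diffusive profile:
for `α, D, λ > 0`, `k > 3/2`, `0 < η < 2/3` and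
`D₂ > max{3D max{1,λ}²/(2-2√(3η/2)), 6D/(1-√(3η/2))}`, there is `C > 0` such that
`∫₀ᵗ ∫_{|y|≤λs} e^{-(|x-y|+(t-s))/D} (1+s)^{-α} B_k(s,|y|) dy ds
  ≤ C (1+t)^{-α} e^{-3(|x|-λt)²/(2D₂(1+t))} + C (1+t)^{-α} B_k(t,|x|) 1_{|x|≤λt}
    + C e^{-3(|x|+t)/(2D₂)}`. -/
theorem singular_profile_coupling (α D lam k η D₂ : ℝ) (hα : 0 < α) (hD : 0 < D)
    (hlam : 0 < lam) (hk : 3 / 2 < k) (hη0 : 0 < η) (hη : η < 2 / 3)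
    (hD₂ : max (3 * D / (2 - 2 * Real.sqrt (3 * η / 2)) * max 1 lam ^ 2)
        (6 * D / (1 - Real.sqrt (3 * η / 2))) < D₂) :
    ∃ C > (0 : ℝ), ∀ t : ℝ, 0 ≤ t → ∀ x : E3,
      (∫⁻ s in Set.Icc (0 : ℝ) t, ∫⁻ y in {y : E3 | ‖y‖ ≤ lam * s},
          ENNReal.ofReal (Real.exp (-(‖x - y‖ + (t - s)) / D) * (1 + s) ^ (-α) *
            Bprof k s ‖y‖)) ≤
        ENNReal.ofReal (C * (1 + t) ^ (-α) *
            Real.exp (-3 * (‖x‖ - lam * t) ^ 2 / (2 * D₂ * (1 + t))) +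
          C * (1 + t) ^ (-α) * (if ‖x‖ ≤ lam * t then Bprof k t ‖x‖ else 0) +
          C * Real.exp (-3 * (‖x‖ + t) / (2 * D₂))) := by
  have hthr : 6 * D ≤ D₂ ∧ 3 / 2 * D * lam ^ 2 ≤ D₂ := by
    obtain ⟨h1, h2⟩ := max_lt_iff.1 hD₂
    have hc0 : 0 ≤ √(3 * η / 2) := sqrt_nonneg _
    have hc1 : √(3 * η / 2) < 1 := by
      rw [sqrt_lt' one_pos]
      linarith
    set c := √(3 * η / 2)
    constructor
    · refine le_trans ?_ h2.le
      rw [le_div_iff₀ (by linarith)]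
      nlinarith
    · refine le_trans ?_ h1.le
      have hcoef : 3 / 2 * D ≤ 3 * D / (2 - 2 * c) := by
        rw [le_div_iff₀ (by linarith)]
        nlinarith
      have hmax : lam ^ 2 ≤ max 1 lam ^ 2 := pow_le_pow_left₀ hlam.le (le_max_right _ _) 2
      exact mul_le_mul hcoef hmax (sq_nonneg _) (le_trans (by positivity) hcoef)
  obtain ⟨h6, hlam₂⟩ := hthr
  have hk0 : 0 < k := by linarith
  obtain ⟨C₁, hC₁, hexp₁⟩ :=
    exists_one_add_rpow_le_mul_exp hα (show 0 < 3 / (4 * D) by positivity)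
  obtain ⟨C₂, hC₂, hexp₂⟩ :=
    exists_one_add_rpow_le_mul_exp (show 0 < 2 * k by positivity)
      (show 0 < 3 / (4 * D) by positivity)
  obtain ⟨K, hK, hcore⟩ := exists_setLIntegral_le_of_le_exp (show 0 < 1 / (4 * D) by positivity)
  have h2k : (0 : ℝ) < 2 ^ k := by positivity
  refine ⟨(C₁ + C₁ * C₂ * 2 ^ k) * K, by positivity, fun t ht x => ?_⟩
  have hpow : 0 < (1 + t) ^ (-α) := rpow_pos_of_pos (by linarith) _
  have hS : ∀ s : ℝ, MeasurableSet {y : E3 | ‖y‖ ≤ lam * s} := fun s =>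
    (isClosed_le continuous_norm continuous_const).measurableSet
  have hsplit : ∀ v : ℝ, exp (-v / D) * exp (3 / (4 * D) * v) = exp (-(1 / (4 * D)) * v) := by
    intro v
    rw [← exp_add]
    congr 1
    field_simp
    ring
  have htime : ∀ s ∈ Set.Icc 0 t, exp (-(t - s) / D) * (1 + s) ^ (-α) ≤
      C₁ * (1 + t) ^ (-α) * exp (-(1 / (4 * D)) * ‖t - s‖) := by
    intro s hs
    have hts : 0 ≤ t - s := sub_nonneg.2 hs.2
    rw [Real.norm_of_nonneg hts, ← hsplit (t - s)]
    calc exp (-(t - s) / D) * (1 + s) ^ (-α)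
        ≤ exp (-(t - s) / D) * ((1 + t) ^ (-α) * (C₁ * exp (3 / (4 * D) * (t - s)))) := by
          gcongr
          exact (one_add_rpow_neg_le hα.le hs.1 hs.2).trans
            (mul_le_mul_of_nonneg_left (hexp₁ _ hts) hpow.le)
      _ = _ := by ring
  have hfactor : ∀ (s : ℝ) (y : E3), exp (-(‖x - y‖ + (t - s)) / D) * (1 + s) ^ (-α) *
      Bprof k s ‖y‖ =
        exp (-(t - s) / D) * (1 + s) ^ (-α) * (exp (-‖x - y‖ / D) * Bprof k s ‖y‖) := by
    intro s y
    rw [show -(‖x - y‖ + (t - s)) / D = -(t - s) / D + -‖x - y‖ / D by ring, exp_add]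
    ring
  -- It suffices to dominate the spatial factor by a constant times a localized exponential.
  have hreduce : ∀ W : ℝ, 0 ≤ W → (∀ s ∈ Set.Icc 0 t, ∀ y : E3, ‖y‖ ≤ lam * s →
      exp (-‖x - y‖ / D) * Bprof k s ‖y‖ ≤ W * exp (-(1 / (4 * D)) * ‖x - y‖)) →
      (∫⁻ s in Set.Icc (0 : ℝ) t, ∫⁻ y in {y : E3 | ‖y‖ ≤ lam * s},
          ENNReal.ofReal (Real.exp (-(‖x - y‖ + (t - s)) / D) * (1 + s) ^ (-α) *
            Bprof k s ‖y‖)) ≤ ENNReal.ofReal (C₁ * (1 + t) ^ (-α) * W * K) := by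
    intro W hW hspace
    refine hcore t x _ (fun s => {y : E3 | ‖y‖ ≤ lam * s}) _ (by positivity) hS
      fun s hs y hy => ?_
    rw [hfactor]
    calc _ ≤ C₁ * (1 + t) ^ (-α) * exp (-(1 / (4 * D)) * ‖t - s‖) *
          (W * exp (-(1 / (4 * D)) * ‖x - y‖)) :=
          mul_le_mul (htime s hs) (hspace s hs y hy)
            (mul_nonneg (exp_pos _).le (Bprof_nonneg k hs.1 _)) (by positivity)
      _ = _ := by ring
  have hgauss : 0 ≤ (1 + t) ^ (-α) * exp (-3 * (‖x‖ - lam * t) ^ 2 / (2 * D₂ * (1 + t))) := by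
    positivity
  have htail : 0 ≤ exp (-3 * (‖x‖ + t) / (2 * D₂)) := (exp_pos _).le
  by_cases hx : ‖x‖ ≤ lam * t
  · have hB := Bprof_nonneg k ht ‖x‖
    refine (hreduce (C₂ * 2 ^ k * Bprof k t ‖x‖) (by positivity) fun s hs y _ => ?_).trans
      (ENNReal.ofReal_le_ofReal ?_)
    · have htri : ‖x‖ ≤ ‖y‖ + ‖x - y‖ := norm_le_norm_add_norm_sub' x y
      rw [← hsplit]
      calc exp (-‖x - y‖ / D) * Bprof k s ‖y‖
          ≤ exp (-‖x - y‖ / D) *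
              (2 ^ k * Bprof k t ‖x‖ * (C₂ * exp (3 / (4 * D) * ‖x - y‖))) := by
            gcongr
            exact (Bprof_le_mul hk0.le hs.1 hs.2 (norm_nonneg _) (norm_nonneg _) htri).trans
              (mul_le_mul_of_nonneg_left (hexp₂ _ (norm_nonneg _)) (by positivity))
        _ = _ := by ring
    · rw [if_pos hx]
      have h1 : 0 ≤ C₁ * K * ((1 + t) ^ (-α) * Bprof k t ‖x‖) := by positivity
      have hCK : 0 ≤ (C₁ + C₁ * C₂ * 2 ^ k) * K := by positivity
      have h2 := mul_nonneg hCK hgauss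
      have h3 := mul_nonneg hCK htail
      linarith
  · rw [not_le] at hx
    refine (hreduce (exp (-(3 * (‖x‖ - lam * t) / (4 * D)))) (exp_pos _).le
      fun s hs y hy => ?_).trans (ENNReal.ofReal_le_ofReal ?_)
    · refine (mul_le_of_le_one_right (exp_pos _).le (Bprof_le_one hk0.le hs.1 _)).trans ?_
      have hdist : ‖x‖ - lam * t ≤ ‖x - y‖ := by
        have := norm_sub_norm_le x y
        have := mul_le_mul_of_nonneg_left hs.2 hlam.le
        linarith
      have hdiv : 3 * (‖x‖ - lam * t) / (4 * D) ≤ 3 * ‖x - y‖ / (4 * D) := by gcongr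
      rw [← exp_add, exp_le_exp]
      calc -‖x - y‖ / D = -(3 * ‖x - y‖ / (4 * D)) + -(1 / (4 * D)) * ‖x - y‖ := by
            field_simp
            ring
        _ ≤ _ := by linarith
    · rw [if_neg hx.not_ge]
      have h := mul_le_mul_of_nonneg_left
        (rpow_mul_exp_neg_dist_le hα.le hD h6 hlam₂ ht hx.le) (mul_pos hC₁ hK).le
      have hCK : 0 ≤ C₁ * C₂ * 2 ^ k * K := by positivity
      have h2 := mul_nonneg hCK hgauss
      have h3 := mul_nonneg hCK htail
      linarith

end
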